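/- arXiv:2202.03839 — 2 statements merged into one kernel-verified Lean document; each statement's English description precedes it below -/
import Mathlib

section
/- Let r ≥ 2 and let (α_1, …, α_r) be a tuple of integers with α_i ≥ 2 for all 1 ≤ i ≤ r. Then ζ*(α_r, …, α_1) + (-1)^r · ζ(α_1, …, α_r) = ∑_{k=1}^{r-1} (-1)^{k+1} · ζ(α_1, …, α_k) · ζ*(α_r, …, α_{k+1}). -/
open scoped BigOperators

/-- The multiple zeta value `ζ(a₁, …, a_r)`, as a sum over strictly increasing
tuples of positive integers. -/
noncomputable def mz (a : List ℕ) : ℝ :=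
  ∑' k : {k : Fin a.length → ℕ+ // StrictMono k},
    ∏ i, (1 : ℝ) / ((k.1 i : ℕ) : ℝ) ^ a.get i

/-- The multiple zeta-star value `ζ⋆(a₁, …, a_r)`, as a sum over weakly increasing
tuples of positive integers. -/
noncomputable def mzs (a : List ℕ) : ℝ :=
  ∑' k : {k : Fin a.length → ℕ+ // Monotone k},
    ∏ i, (1 : ℝ) / ((k.1 i : ℕ) : ℝ) ^ a.get i

/-- The summand `∏ 1 / kᵢ ^ aᵢ` of a multiple zeta value. -/
noncomputable def mzTerm {n : ℕ} (a : Fin n → ℕ) (k : Fin n → ℕ+) : ℝ :=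
  ∏ i, (1 : ℝ) / ((k i : ℕ) : ℝ) ^ a i

/-- The tuples that are strictly increasing on the indices below `p` and weakly decreasing on the
indices from `q` on. -/
def peakSet (n p q : ℕ) : Set (Fin n → ℕ+) :=
  {k | (∀ i j : Fin n, i < j → j.1 < p → k i < k j) ∧
    ∀ i j : Fin n, q ≤ i.1 → i ≤ j → k j ≤ k i}

lemma mzTerm_nonneg {n : ℕ} (a : Fin n → ℕ) (k : Fin n → ℕ+) : 0 ≤ mzTerm a k :=
  Finset.prod_nonneg fun _ _ => by positivity

lemma mzTerm_append {p q : ℕ} (a : Fin (p + q) → ℕ) (k : Fin p → ℕ+) (l : Fin q → ℕ+) :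
    mzTerm a (Fin.append k l) =
      mzTerm (fun i => a (Fin.castAdd q i)) k * mzTerm (fun i => a (Fin.natAdd p i)) l := by
  simp only [mzTerm, Fin.prod_univ_add, Fin.append_left, Fin.append_right]

lemma summable_one_div_pnat_pow {s : ℕ} (hs : 2 ≤ s) :
    Summable fun m : ℕ+ => (1 : ℝ) / ((m : ℕ) : ℝ) ^ s :=
  (Real.summable_one_div_nat_pow.2 hs).comp_injective PNat.coe_injective

lemma summable_mzTerm {n : ℕ} (a : Fin n → ℕ) (ha : ∀ i, 2 ≤ a i) : Summable (mzTerm a) := by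
  induction n with
  | zero => exact Summable.of_finite
  | succ n ih =>
    rw [← (Fin.consEquiv fun _ : Fin (n + 1) => ℕ+).summable_iff]
    refine ((summable_one_div_pnat_pow (ha 0)).mul_of_nonneg
      (ih (fun i => a i.succ) fun i => ha _) (fun _ => by positivity)
      (mzTerm_nonneg _)).congr fun x => ?_
    simp [mzTerm, Fin.prod_univ_succ, Fin.consEquiv, mul_comm]

lemma mz_ofFn {n : ℕ} (a : Fin n → ℕ) :
    mz (List.ofFn a) = ∑' k, {k : Fin n → ℕ+ | StrictMono k}.indicator (mzTerm a) k := by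
  have key : ∀ (l : List ℕ) (h : l.length = n), mz l =
      ∑' k : {k : Fin n → ℕ+ // StrictMono k}, mzTerm (fun i => l.get (Fin.cast h.symm i)) k.1 := by
    rintro l rfl
    rfl
  rw [key _ List.length_ofFn, ← tsum_subtype]
  simp
  rfl

lemma mzs_ofFn {n : ℕ} (a : Fin n → ℕ) :
    mzs (List.ofFn a) = ∑' k, {k : Fin n → ℕ+ | Monotone k}.indicator (mzTerm a) k := by
  have key : ∀ (l : List ℕ) (h : l.length = n), mzs l =
      ∑' k : {k : Fin n → ℕ+ // Monotone k}, mzTerm (fun i => l.get (Fin.cast h.symm i)) k.1 := by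
    rintro l rfl
    rfl
  rw [key _ List.length_ofFn, ← tsum_subtype]
  simp
  rfl

lemma mzs_ofFn_rev {n : ℕ} (a : Fin n → ℕ) :
    mzs (List.ofFn fun i => a i.rev) =
      ∑' k, {k : Fin n → ℕ+ | Antitone k}.indicator (mzTerm a) k := by
  rw [mzs_ofFn, ← (Equiv.arrowCongr Fin.revPerm (Equiv.refl ℕ+)).tsum_eq]
  refine tsum_congr fun k => ?_
  have hterm : mzTerm (fun i => a i.rev) (fun i => k i.rev) = mzTerm a k :=
    Equiv.prod_comp Fin.revPerm fun i => (1 : ℝ) / ((k i : ℕ) : ℝ) ^ a i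
  have hmem : (Monotone fun i : Fin n => k i.rev) ↔ Antitone k :=
    ⟨fun h i j hij => by
      have h' := @h j.rev i.rev (Fin.rev_le_rev.2 hij)
      simpa only [Fin.rev_rev] using h',
      fun h i j hij => h (Fin.rev_le_rev.2 hij)⟩
  have hk : Equiv.arrowCongr Fin.revPerm (Equiv.refl ℕ+) k = fun i => k i.rev := rfl
  classical
  rw [hk, Set.indicator_apply, Set.indicator_apply, hterm]
  simp only [Set.mem_ofPred_eq, hmem]

lemma append_mem_peakSet {p q : ℕ} (k : Fin p → ℕ+) (l : Fin q → ℕ+) :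
    Fin.append k l ∈ peakSet (p + q) p p ↔ StrictMono k ∧ Antitone l := by
  constructor
  · rintro ⟨h₁, h₂⟩
    refine ⟨fun i j hij => ?_, fun i j hij => ?_⟩
    · simpa using h₁ (Fin.castAdd q i) (Fin.castAdd q j) hij (by simp)
    · simpa using h₂ (Fin.natAdd p i) (Fin.natAdd p j) (by simp) (by simpa using hij)
  · rintro ⟨hk, hl⟩
    refine ⟨fun i j hij hj => ?_, fun i j hi hij => ?_⟩
    · obtain ⟨i, rfl⟩ : ∃ i', i = Fin.castAdd q i' := ⟨⟨i, by omega⟩, rfl⟩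
      obtain ⟨j, rfl⟩ : ∃ j', j = Fin.castAdd q j' := ⟨⟨j, by omega⟩, rfl⟩
      simpa using hk (Fin.lt_def.2 hij : i < j)
    · obtain ⟨i, rfl⟩ : ∃ i', i = Fin.natAdd p i' :=
        ⟨⟨i - p, by omega⟩, by ext; simp; omega⟩
      obtain ⟨j, rfl⟩ : ∃ j', j = Fin.natAdd p j' :=
        ⟨⟨j - p, by omega⟩, by ext; simp; omega⟩
      simpa using hl (by simpa using hij)

lemma mz_mul_mzs {r p q : ℕ} (h : r = p + q) (a : Fin r → ℕ) (ha : ∀ i, 2 ≤ a i) :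
    mz (List.ofFn fun i : Fin p => a ⟨i.1, by omega⟩) *
        mzs (List.ofFn fun i : Fin q => a ⟨r - 1 - i.1, by omega⟩) =
      ∑' k, (peakSet r p p).indicator (mzTerm a) k := by
  subst h
  have hrev : (fun i : Fin q => a ⟨p + q - 1 - i.1, by omega⟩) =
      fun i => a (Fin.natAdd p i.rev) := by
    funext i
    congr 1
    ext
    simp
    omega
  have hl := mzs_ofFn_rev fun i => a (Fin.natAdd p i)
  rw [hrev, hl, mz_ofFn, tsum_mul_tsum_of_summable_norm
    (((summable_mzTerm _ fun i => ha _).indicator _).norm)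
    (((summable_mzTerm _ fun i => ha _).indicator _).norm),
    ← (Fin.appendEquiv p q).tsum_eq]
  refine tsum_congr fun ⟨k, l⟩ => ?_
  have hkl : Fin.appendEquiv p q (k, l) = Fin.append k l := rfl
  classical
  rw [hkl]
  simp only [Set.indicator_apply, append_mem_peakSet, mzTerm_append, Set.mem_ofPred_eq,
    ite_and, ite_mul, mul_ite, zero_mul, mul_zero]
  split_ifs <;> rfl

lemma peakSet_succ_eq_union {r s : ℕ} (hs : s + 1 < r) :
    peakSet r (s + 1) (s + 1) = peakSet r (s + 1) s ∪ peakSet r (s + 2) (s + 1) := by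
  ext k
  constructor
  · rintro ⟨h₁, h₂⟩
    rcases le_or_gt (k ⟨s + 1, hs⟩) (k ⟨s, by omega⟩) with h | h
    · refine Or.inl ⟨h₁, fun i j hi hij => ?_⟩
      rcases hi.eq_or_lt with rfl | hi
      · rcases hij.eq_or_lt with rfl | hij
        · exact le_rfl
        · exact (h₂ ⟨_, hs⟩ j le_rfl hij).trans h
      · exact h₂ i j hi hij
    · refine Or.inr ⟨fun i j hij hj => ?_, h₂⟩
      rcases (Nat.le_of_lt_succ hj).eq_or_lt with hj | hj
      · obtain rfl : j = ⟨s + 1, hs⟩ := Fin.ext hj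
        have hi : i.1 ≤ s := Nat.le_of_lt_succ hij
        rcases hi.eq_or_lt with rfl | hi
        · exact h
        · exact (h₁ i ⟨s, by omega⟩ hi (Nat.lt_succ_self s)).trans h
      · exact h₁ i j hij hj
  · rintro (⟨h₁, h₂⟩ | ⟨h₁, h₂⟩)
    · exact ⟨h₁, fun i j hi => h₂ i j (by omega)⟩
    · exact ⟨fun i j hij hj => h₁ i j hij (by omega), h₂⟩

lemma disjoint_peakSet {r s : ℕ} (hs : s + 1 < r) :
    Disjoint (peakSet r (s + 1) s) (peakSet r (s + 2) (s + 1)) := by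
  refine Set.disjoint_left.2 fun k hk hk' => ?_
  have hle := hk.2 ⟨s, by omega⟩ ⟨s + 1, hs⟩ le_rfl (Nat.le_succ s)
  exact hle.not_gt (hk'.1 ⟨s, by omega⟩ ⟨s + 1, hs⟩ (Nat.lt_succ_self s) (Nat.lt_succ_self _))

lemma tsum_peakSet_succ {r s : ℕ} (hs : s + 1 < r) {f : (Fin r → ℕ+) → ℝ} (hf : Summable f) :
    ∑' k, (peakSet r (s + 1) (s + 1)).indicator f k =
      ∑' k, (peakSet r (s + 1) s).indicator f k +
        ∑' k, (peakSet r (s + 2) (s + 1)).indicator f k := by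
  rw [← (hf.indicator _).tsum_add (hf.indicator _), peakSet_succ_eq_union hs,
    Set.indicator_union_of_disjoint (disjoint_peakSet hs)]

lemma sum_neg_one_pow_mul_add_succ (T : ℕ → ℝ) (n : ℕ) :
    ∑ j ∈ Finset.range n, (-1 : ℝ) ^ (j + 1 + 1) * (T j + T (j + 1)) =
      T 0 + (-1 : ℝ) ^ (n + 1) * T n := by
  induction n with
  | zero => simp
  | succ n ih =>
    rw [Finset.sum_range_succ, ih]
    ring

/-- For a tuple `(α₁, …, α_r)` of integers with `r ≥ 2` and `αᵢ ≥ 2` for all `i`,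
`ζ⋆(α_r,…,α₁) + (-1)^r ζ(α₁,…,α_r) = ∑_{k=1}^{r-1} (-1)^{k+1} ζ(α₁,…,α_k) ζ⋆(α_r,…,α_{k+1})`. -/
theorem mzs_reverse_add_mz (r : ℕ) (hr : 2 ≤ r) (a : Fin r → ℕ)
    (hge : ∀ i, 2 ≤ a i) :
    mzs (List.ofFn (fun i : Fin r => a ⟨r - 1 - i.1, by omega⟩)) +
      (-1 : ℝ) ^ r * mz (List.ofFn a) =
    ∑ j : Fin (r - 1),
      (-1 : ℝ) ^ ((j.1 + 1) + 1) *
        mz (List.ofFn (fun i : Fin (j.1 + 1) =>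
          a ⟨i.1, by have := j.isLt; have := i.isLt; omega⟩)) *
        mzs (List.ofFn (fun i : Fin (r - (j.1 + 1)) =>
          a ⟨r - 1 - i.1, by omega⟩)) := by
  have hf := summable_mzTerm a hge
  have hstar : mzs (List.ofFn (fun i : Fin r => a ⟨r - 1 - i.1, by omega⟩)) =
      ∑' k, (peakSet r 1 0).indicator (mzTerm a) k := by
    have hrev : (fun i : Fin r => a ⟨r - 1 - i.1, by omega⟩) = fun i => a i.rev := by
      funext i
      congr 1
      ext
      simp
      omega
    have hset : {k : Fin r → ℕ+ | Antitone k} = peakSet r 1 0 :=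
      Set.ext fun k => ⟨fun h => ⟨fun i j hij hj => by omega, fun i j _ hij => h hij⟩,
        fun h i j hij => h.2 i j (Nat.zero_le _) hij⟩
    rw [hrev, mzs_ofFn_rev, hset]
  have hz : mz (List.ofFn a) = ∑' k, (peakSet r r (r - 1)).indicator (mzTerm a) k := by
    have hset : {k : Fin r → ℕ+ | StrictMono k} = peakSet r r (r - 1) :=
      Set.ext fun k => ⟨fun h => ⟨fun i j hij _ => h hij, fun i j hi hij => by
          obtain rfl : i = j := by omega
          exact le_rfl⟩,
        fun h i j hij => h.1 i j hij j.2⟩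
    rw [mz_ofFn, hset]
  have htel := sum_neg_one_pow_mul_add_succ
    (fun j => ∑' k, (peakSet r (j + 1) j).indicator (mzTerm a) k) (r - 1)
  have hr' : r - 1 + 1 = r := by omega
  simp only [hr'] at htel
  rw [hstar, hz, ← htel, ← Fin.sum_univ_eq_sum_range
    (fun j => (-1 : ℝ) ^ (j + 1 + 1) * (∑' k, (peakSet r (j + 1) j).indicator (mzTerm a) k +
      ∑' k, (peakSet r (j + 1 + 1) (j + 1)).indicator (mzTerm a) k))]
  refine Finset.sum_congr rfl fun j _ => ?_
  rw [mul_assoc, mz_mul_mzs (by omega) a hge, tsum_peakSet_succ (by omega) hf]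
end

section
/- For every integer n ≥ 0, ζ*(1, {2}^{n+1}) = 2·ζ(2n+3). -/
open scoped BigOperators

open Filter Topology Finset

/-- The ratio `N.choose k / (N + k).choose k`, written as a product. -/
noncomputable def chooseRatio (N k : ℕ) : ℝ :=
  ∏ i ∈ range k, ((N : ℝ) - i) / (N + 1 + i)

lemma chooseRatio_succ_right (N k : ℕ) :
    chooseRatio N (k + 1) * (N + 1 + k) = chooseRatio N k * (N - k) := by
  have : (N : ℝ) + 1 + k ≠ 0 := by positivity
  rw [chooseRatio, prod_range_succ, ← chooseRatio]
  field_simp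

lemma chooseRatio_succ_left (N k : ℕ) :
    chooseRatio (N + 1) k * ((N + 1) ^ 2 - k ^ 2) = chooseRatio N k * (N + 1) ^ 2 := by
  induction k with
  | zero => simp [chooseRatio]
  | succ k ih =>
    have h₁ := chooseRatio_succ_right (N + 1) k
    have h₂ := chooseRatio_succ_right N k
    have hpos : (N : ℝ) + 1 + k ≠ 0 := by positivity
    apply mul_right_cancel₀ hpos
    push_cast at h₁ ⊢
    linear_combination (N - k) * (N + 1 + k) * h₁ + (N - k) * ih - (N + 1) ^ 2 * h₂

lemma chooseRatio_eq_zero {N k : ℕ} (h : N < k) : chooseRatio N k = 0 :=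
  prod_eq_zero (mem_range.2 h) (by simp)

lemma chooseRatio_nonneg (N k : ℕ) : 0 ≤ chooseRatio N k := by
  rcases lt_or_ge N k with h | h
  · rw [chooseRatio_eq_zero h]
  · refine prod_nonneg fun i hi => div_nonneg (sub_nonneg.2 ?_) (by positivity)
    exact_mod_cast (mem_range.1 hi).le.trans h

lemma chooseRatio_le_one (N k : ℕ) : chooseRatio N k ≤ 1 := by
  rcases lt_or_ge N k with h | h
  · rw [chooseRatio_eq_zero h]
    exact zero_le_one
  · refine prod_le_one (fun i hi => div_nonneg (sub_nonneg.2 ?_) (by positivity)) fun i _ => ?_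
    · exact_mod_cast (mem_range.1 hi).le.trans h
    · rw [div_le_one (by positivity)]
      have : (0 : ℝ) ≤ i := i.cast_nonneg
      linarith

lemma tendsto_chooseRatio (k : ℕ) : Tendsto (fun N => chooseRatio N k) atTop (𝓝 1) := by
  have key (i : ℕ) :
      Tendsto (fun N : ℕ => ((N : ℝ) - i) / (N + 1 + i)) atTop (𝓝 1) := by
    have hinv : Tendsto (fun N : ℕ => ((N : ℝ) + (1 + i))⁻¹) atTop (𝓝 0) :=
      tendsto_inv_atTop_zero.comp
        (tendsto_atTop_add_const_right _ _ tendsto_natCast_atTop_atTop)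
    have h := (hinv.const_mul (1 + 2 * (i : ℝ))).const_sub 1
    rw [mul_zero, sub_zero] at h
    refine h.congr fun N => ?_
    have : (N : ℝ) + 1 + i ≠ 0 := by positivity
    rw [← add_assoc]
    field_simp
    ring
  simpa [chooseRatio] using tendsto_finsetProd (range k) fun i _ => key i

lemma two_mul_sum_mul_chooseRatio (N : ℕ) :
    2 * ∑ k ∈ range N, ((k : ℝ) + 1) * chooseRatio N (k + 1) = N := by
  have key (M : ℕ) : 2 * ∑ k ∈ range M, ((k : ℝ) + 1) * chooseRatio N (k + 1) =
      N - chooseRatio N M * (N - M) := by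
    induction M with
    | zero => simp [chooseRatio]
    | succ M ih =>
      rw [sum_range_succ, mul_add, ih]
      have := chooseRatio_succ_right N M
      push_cast
      linear_combination this
  simpa using key N

/-- The truncation `k_r ≤ N` of the zeta-star value `ζ⋆(1, {2}^r)`, by recursion on `r`. -/
noncomputable def truncStar : ℕ → ℕ → ℝ
  | 0, N => ∑ m ∈ range N, 1 / ((m : ℝ) + 1)
  | r + 1, N => ∑ m ∈ range N, truncStar r (m + 1) / ((m : ℝ) + 1) ^ 2

lemma sum_chooseRatio_succ_mul (N : ℕ) (w : ℕ → ℝ) :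
    ∑ k ∈ range (N + 1), chooseRatio (N + 1) (k + 1) * w k =
      ∑ k ∈ range N, chooseRatio N (k + 1) * w k +
      (∑ k ∈ range (N + 1), chooseRatio (N + 1) (k + 1) * (((k : ℝ) + 1) ^ 2 * w k)) /
        ((N : ℝ) + 1) ^ 2 := by
  have hext : ∑ k ∈ range N, chooseRatio N (k + 1) * w k =
      ∑ k ∈ range (N + 1), chooseRatio N (k + 1) * w k := by
    rw [sum_range_succ, chooseRatio_eq_zero N.lt_succ_self, zero_mul, add_zero]
  rw [hext, sum_div, ← sum_add_distrib]
  refine sum_congr rfl fun k _ => ?_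
  have h := chooseRatio_succ_left N (k + 1)
  push_cast at h
  field_simp
  linear_combination w k * h

lemma truncStar_eq (r N : ℕ) :
    truncStar r N =
      2 * ∑ k ∈ range N, chooseRatio N (k + 1) / ((k : ℝ) + 1) ^ (2 * r + 1) := by
  induction r generalizing N with
  | zero =>
    induction N with
    | zero => simp [truncStar]
    | succ N ih =>
      have hsum : ∑ m ∈ range (N + 1), 1 / ((m : ℝ) + 1) = truncStar 0 N + 1 / ((N : ℝ) + 1) :=
        sum_range_succ _ _
      have hN : (N : ℝ) + 1 ≠ 0 := by positivity
      have h := two_mul_sum_mul_chooseRatio (N + 1)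
      have hstep := sum_chooseRatio_succ_mul N fun k => 1 / ((k : ℝ) + 1) ^ 1
      have hweight : ∑ k ∈ range (N + 1),
          chooseRatio (N + 1) (k + 1) * (((k : ℝ) + 1) ^ 2 * (1 / ((k : ℝ) + 1) ^ 1)) =
          ∑ k ∈ range (N + 1), ((k : ℝ) + 1) * chooseRatio (N + 1) (k + 1) :=
        sum_congr rfl fun k _ => by field_simp
      rw [hweight] at hstep
      simp only [mul_one_div] at hstep
      rw [truncStar, hsum, ih, mul_zero, zero_add, hstep, mul_add, mul_div_assoc', h]
      push_cast
      field_simp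
  | succ r ih =>
    induction N with
    | zero => simp [truncStar]
    | succ N ihN =>
      have hsum : truncStar (r + 1) (N + 1) =
          truncStar (r + 1) N + truncStar r (N + 1) / ((N : ℝ) + 1) ^ 2 :=
        sum_range_succ _ _
      have hstep := sum_chooseRatio_succ_mul N fun k => 1 / ((k : ℝ) + 1) ^ (2 * (r + 1) + 1)
      have hweight : ∑ k ∈ range (N + 1), chooseRatio (N + 1) (k + 1) *
          (((k : ℝ) + 1) ^ 2 * (1 / ((k : ℝ) + 1) ^ (2 * (r + 1) + 1))) =
          ∑ k ∈ range (N + 1), chooseRatio (N + 1) (k + 1) / ((k : ℝ) + 1) ^ (2 * r + 1) :=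
        sum_congr rfl fun k _ => by
          rw [show 2 * (r + 1) + 1 = 2 * r + 1 + 2 by ring, pow_add]
          field_simp
      rw [hweight] at hstep
      simp only [mul_one_div] at hstep
      rw [hsum, ihN, ih, hstep]
      ring

lemma summable_one_div_succ_pow {s : ℕ} (hs : 1 < s) :
    Summable fun k : ℕ => 1 / ((k : ℝ) + 1) ^ s := by
  have := (summable_nat_add_iff 1).2 (Real.summable_one_div_nat_pow.2 hs)
  simpa using this

lemma tendsto_truncStar (r : ℕ) :
    Tendsto (truncStar (r + 1)) atTop (𝓝 (2 * ∑' k : ℕ, 1 / ((k : ℝ) + 1) ^ (2 * r + 3))) := by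
  have hlim : Tendsto
      (fun N => ∑' k : ℕ, chooseRatio N (k + 1) / ((k : ℝ) + 1) ^ (2 * r + 3)) atTop
      (𝓝 (∑' k : ℕ, 1 / ((k : ℝ) + 1) ^ (2 * r + 3))) := by
    refine tendsto_tsum_of_dominated_convergence
      (summable_one_div_succ_pow (show 1 < 2 * r + 3 by omega))
      (fun k => (tendsto_chooseRatio (k + 1)).div_const _)
      (Eventually.of_forall fun N k => ?_)
    rw [Real.norm_of_nonneg (div_nonneg (chooseRatio_nonneg _ _) (by positivity))]
    gcongr
    exact chooseRatio_le_one _ _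
  refine (hlim.const_mul 2).congr fun N => ?_
  rw [truncStar_eq, tsum_eq_sum (s := range N)]
  · rfl
  · intro k hk
    rw [chooseRatio_eq_zero (by simpa [Nat.lt_succ_iff] using hk), zero_div]

/-- The summand of `ζ⋆(1, {2}^r)`. -/
noncomputable def starTerm {r : ℕ} (k : Fin (r + 1) → ℕ+) : ℝ :=
  ∏ i, (1 : ℝ) / ((k i : ℕ) : ℝ) ^ (if i = 0 then 1 else 2)

lemma starTerm_nonneg {r : ℕ} (k : Fin (r + 1) → ℕ+) : 0 ≤ starTerm k :=
  prod_nonneg fun _ _ => by positivity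

lemma starTerm_snoc {r : ℕ} (k : Fin (r + 1) → ℕ+) (m : ℕ+) :
    starTerm (Fin.snoc k m : Fin (r + 2) → ℕ+) = starTerm k / ((m : ℕ) : ℝ) ^ 2 := by
  rw [starTerm, Fin.prod_univ_castSucc]
  simp [starTerm, div_eq_mul_inv, Fin.last_eq_zero_iff]

/-- The tuples of positive integers at most `N`. -/
def tuplesLE (r N : ℕ) : Finset (Fin r → ℕ+) :=
  Fintype.piFinset fun _ => (range N).image Nat.succPNat

lemma mem_tuplesLE {r N : ℕ} {k : Fin r → ℕ+} :
    k ∈ tuplesLE r N ↔ ∀ i, (k i : ℕ) ≤ N := by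
  simp only [tuplesLE, Fintype.mem_piFinset, mem_image, mem_range]
  refine forall_congr' fun i => ⟨?_, fun h => ⟨(k i).natPred, ?_, PNat.succPNat_natPred _⟩⟩
  · rintro ⟨m, hm, h⟩
    rw [← h]
    exact hm
  · have := PNat.natPred_add_one (k i)
    omega

lemma monotone_snoc_iff {r : ℕ} {k : Fin (r + 1) → ℕ+} {m : ℕ+} :
    Monotone (Fin.snoc k m : Fin (r + 2) → ℕ+) ↔ Monotone k ∧ ∀ i, k i ≤ m := by
  refine ⟨fun h => ⟨fun i j hij => ?_, fun i => ?_⟩, fun ⟨h, hm⟩ i j => ?_⟩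
  · simpa using h (Fin.castSucc_le_castSucc_iff.2 hij)
  · simpa using h (Fin.le_last i.castSucc)
  · refine Fin.lastCases (fun hi => ?_) (fun j => ?_) j
    · refine Fin.lastCases le_rfl (fun i => ?_) i
      simpa using hm i
    · refine Fin.lastCases (fun hij => ?_) (fun i hij => ?_) i
      · exact absurd hij (not_le.2 (Fin.castSucc_lt_last j))
      · simpa using h (Fin.castSucc_le_castSucc_iff.1 hij)

open Classical in
lemma sum_starTerm (r N : ℕ) :
    ∑ k ∈ (tuplesLE (r + 1) N).filter Monotone, starTerm k = truncStar r N := by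
  induction r generalizing N with
  | zero =>
    refine (sum_bij' (fun m _ => fun _ => m.succPNat) (fun k _ => (k 0).natPred)
      ?_ ?_ ?_ ?_ ?_).symm
    · intro m hm
      simp only [mem_filter, mem_tuplesLE, zero_add]
      exact ⟨fun _ => mem_range.1 hm, monotone_const⟩
    · intro k hk
      have := mem_tuplesLE.1 (mem_filter.1 hk).1 0
      have := PNat.natPred_add_one (k 0)
      rw [mem_range]
      omega
    · intro m _
      simp
    · intro k _
      ext i
      simp [Fin.fin_one_eq_zero i]
    · intro m _
      simp [starTerm]
  | succ r ih =>
    simp only [truncStar, ← ih, sum_div]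
    rw [sum_sigma']
    refine (sum_bij' (fun p _ => (Fin.snoc p.2 p.1.succPNat : Fin (r + 2) → ℕ+))
      (fun k _ => ⟨(k (Fin.last _)).natPred, Fin.init k⟩) ?_ ?_ ?_ ?_ ?_).symm
    · rintro ⟨m, k⟩ h
      simp only [mem_sigma, mem_range, mem_filter, mem_tuplesLE] at h ⊢
      obtain ⟨hm, hk, hmono⟩ := h
      refine ⟨fun i => ?_, monotone_snoc_iff.2 ⟨hmono, hk⟩⟩
      refine Fin.lastCases ?_ (fun i => ?_) i
      · simpa using hm
      · simpa using (hk i).trans hm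
    · intro k h
      simp only [mem_sigma, mem_range, mem_filter, mem_tuplesLE] at h ⊢
      obtain ⟨hk, hmono⟩ := h
      have := PNat.natPred_add_one (k (Fin.last _))
      refine ⟨by have := hk (Fin.last _); omega, fun i => ?_,
        fun i j hij => hmono (Fin.castSucc_le_castSucc_iff.2 hij)⟩
      rw [this]
      exact hmono (Fin.le_last i.castSucc)
    · rintro ⟨m, k⟩ _
      simp
    · intro k _
      simp
    · rintro ⟨m, k⟩ _
      simp [starTerm_snoc]

lemma hasSum_of_tendsto_sum_of_monotone {ι : Type*} {f : ι → ℝ} (hf : ∀ i, 0 ≤ f i)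
    {F : ℕ → Finset ι} (hF : Monotone F) (hmem : ∀ i, ∃ N, i ∈ F N) {L : ℝ}
    (hL : Tendsto (fun N => ∑ i ∈ F N, f i) atTop (𝓝 L)) : HasSum f L := by
  have htop : Tendsto F atTop atTop := tendsto_atTop_finset_of_monotone hF hmem
  have hmono : Monotone fun N => ∑ i ∈ F N, f i := fun a b hab =>
    sum_le_sum_of_subset_of_nonneg (hF hab) fun i _ _ => hf i
  have hsum : Summable f := by
    refine summable_of_sum_le hf (c := L) fun u => ?_
    obtain ⟨N, hN⟩ := (htop.eventually_ge_atTop u).exists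
    exact (sum_le_sum_of_subset_of_nonneg hN fun i _ _ => hf i).trans (hmono.ge_of_tendsto hL N)
  have := tendsto_nhds_unique (hsum.hasSum.comp htop) hL
  exact this ▸ hsum.hasSum

lemma tsum_starTerm (r : ℕ) :
    ∑' k : {k : Fin (r + 2) → ℕ+ // Monotone k}, starTerm k.1 =
      2 * ∑' k : ℕ, 1 / ((k : ℝ) + 1) ^ (2 * r + 3) := by
  classical
  refine HasSum.tsum_eq (hasSum_of_tendsto_sum_of_monotone
    (f := fun k : {k : Fin (r + 2) → ℕ+ // Monotone k} => starTerm k.1)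
    (F := fun N => (tuplesLE (r + 2) N).subtype Monotone)
    (fun k => starTerm_nonneg k.1) ?_ ?_ ?_)
  · intro a b hab k hk
    simp only [mem_subtype, mem_tuplesLE] at hk ⊢
    exact fun i => (hk i).trans hab
  · intro k
    refine ⟨k.1 (Fin.last _), ?_⟩
    simp only [mem_subtype, mem_tuplesLE]
    exact fun i => k.2 (Fin.le_last i)
  · refine (tendsto_truncStar r).congr fun N => ?_
    rw [← sum_starTerm, sum_subtype_eq_sum_filter]

lemma mzs_eq_tsum_of_length (a : List ℕ) {r : ℕ} (h : r = a.length) :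
    mzs a = ∑' k : {k : Fin r → ℕ+ // Monotone k},
      ∏ i, (1 : ℝ) / ((k.1 i : ℕ) : ℝ) ^ a.get (i.cast h) := by
  subst h
  rfl

lemma mzs_one_two_pow (r : ℕ) :
    mzs (1 :: List.replicate r 2) =
      ∑' k : {k : Fin (r + 1) → ℕ+ // Monotone k}, starTerm k.1 := by
  rw [mzs_eq_tsum_of_length (r := r + 1) _ (by simp)]
  refine tsum_congr fun k => prod_congr rfl fun i _ => ?_
  congr 2
  refine Fin.cases ?_ (fun i => ?_) i <;> simp

lemma mz_singleton (s : ℕ) : mz [s] = ∑' k : ℕ, 1 / ((k : ℝ) + 1) ^ s := by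
  let e : ℕ ≃ {k : Fin [s].length → ℕ+ // StrictMono k} :=
    { toFun := fun m => ⟨fun _ => m.succPNat, Subsingleton.strictMono (α := Fin 1) _⟩
      invFun := fun k => (k.1 (0 : Fin 1)).natPred
      left_inv := fun m => by simp
      right_inv := fun k => Subtype.ext <| funext fun i => by
        simp [Subsingleton.elim (α := Fin 1) i 0] }
  rw [mz, ← e.tsum_eq]
  refine tsum_congr fun m => ?_
  simp [e]

/-- For every integer `n ≥ 0`, `ζ⋆(1, {2}^{n+1}) = 2 ζ(2n+3)`. -/
theorem zetaStar_one_two_pow (n : ℕ) :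
    mzs (1 :: List.replicate (n + 1) 2) = 2 * mz [2 * n + 3] := by
  rw [mzs_one_two_pow, tsum_starTerm, mz_singleton]
end
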